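/- There exists a universal constant C > 0 such that the following holds. If ‖x⋆‖ ≥ 1 and m ≥ C·d·‖x⋆‖⁴, then with probability at least 1 − 2·exp(−d) over the draw of (a₁, …, a_m), simultaneously for every x ∈ ℝ^d with 0 < ‖x‖ ≤ 3‖x⋆‖ one has (1/m) Σ_{i=1}^m exp(−⟨aᵢ, x⟩)·|⟨aᵢ, x − x⋆⟩|·𝟙{⟨aᵢ, x⟩ > 0} ≥ ‖x − x⋆‖ / (4·√π·(1 + 9π·‖x⋆‖²)); in particular the explicit subgradient selection g satisfies ⟨g(x), x − x⋆⟩ ≥ ‖x − x⋆‖ / (4·√π·(1 + 9π·‖x⋆‖²)) for all such x. -/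

import Mathlib

open MeasureTheory ProbabilityTheory Real
open scoped RealInnerProductSpace ENNReal BigOperators Classical

noncomputable section

/-- Standard Gaussian measure `N(0, I_d)` on `ℝ^d`. -/
def stdGaussian (d : ℕ) : Measure (EuclideanSpace ℝ (Fin d)) :=
  (Measure.pi fun _ : Fin d => gaussianReal 0 1).map (EuclideanSpace.equiv (Fin d) ℝ).symm

/-- The joint distribution of `m` i.i.d. standard Gaussian vectors in `ℝ^d`. -/
def iidGaussian (d m : ℕ) : Measure (Fin m → EuclideanSpace ℝ (Fin d)) :=
  Measure.pi fun _ : Fin m => stdGaussian d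

/-- The loss `f(x) = (1/m) ∑ᵢ |yᵢ - hᵢ(x)|` where `yᵢ = 1 - exp(-⟨aᵢ,x⋆⟩₊)` and
`hᵢ(x) = 1 - exp(-⟨aᵢ,x⟩₊)`. -/
def loss {d m : ℕ} (xstar : EuclideanSpace ℝ (Fin d))
    (a : Fin m → EuclideanSpace ℝ (Fin d)) (x : EuclideanSpace ℝ (Fin d)) : ℝ :=
  (1 / m) * ∑ i, |(1 - Real.exp (-max ⟪a i, xstar⟫ 0)) - (1 - Real.exp (-max ⟪a i, x⟫ 0))|

/-- The complementary error function `erfc(t) = (2/√π) ∫_t^∞ exp(-u²) du`. -/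
def erfc (t : ℝ) : ℝ := 2 / Real.sqrt π * ∫ u in Set.Ioi t, Real.exp (-u ^ 2)

/-- `sgn₀(t) = 1` for `t > 0`, `-1` for `t < 0`, and `0` at `t = 0`. -/
def sgn0 (t : ℝ) : ℝ := if 0 < t then 1 else if t < 0 then -1 else 0

/-- `𝟙₊(t) = 1` for `t ≥ 0` and `0` for `t < 0`. -/
def indNonneg (t : ℝ) : ℝ := if 0 ≤ t then 1 else 0

/-- The explicit subgradient selection
`g(x) = -(1/m) ∑ᵢ sgn₀(yᵢ - hᵢ(x)) exp(-⟨aᵢ,x⟩₊) 𝟙₊(⟨aᵢ,x⟩) aᵢ`. -/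
def subgrad {d m : ℕ} (xstar : EuclideanSpace ℝ (Fin d))
    (a : Fin m → EuclideanSpace ℝ (Fin d)) (x : EuclideanSpace ℝ (Fin d)) :
    EuclideanSpace ℝ (Fin d) :=
  -((1 / m : ℝ) • ∑ i,
      (sgn0 ((1 - Real.exp (-max ⟪a i, xstar⟫ 0)) - (1 - Real.exp (-max ⟪a i, x⟫ 0))) *
        Real.exp (-max ⟪a i, x⟫ 0) * indNonneg ⟪a i, x⟫) • a i)


section aux
open Metric Module

lemma ua_card_sep {d : ℕ} {ε : ℝ} (hε : 0 < ε) (s : Finset (EuclideanSpace ℝ (Fin d)))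
    (hs : ∀ c ∈ s, ‖c‖ = 1)
    (h : ∀ c ∈ s, ∀ e ∈ s, c ≠ e → ε ≤ ‖c - e‖) : (s.card : ℝ) ≤ (1 + 2 / ε) ^ d := by
  let μ : Measure (EuclideanSpace ℝ (Fin d)) := volume
  let δ : ℝ := ε / 2
  let ρ : ℝ := 1 + ε / 2
  have δpos : 0 < δ := by positivity
  have ρpos : 0 < ρ := by positivity
  set A := ⋃ c ∈ s, ball (c : EuclideanSpace ℝ (Fin d)) δ with hA
  have D : Set.Pairwise (s : Set (EuclideanSpace ℝ (Fin d)))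
      (Function.onFun Disjoint fun c => ball (c : EuclideanSpace ℝ (Fin d)) δ) := by
    rintro c hc e he hcd
    apply ball_disjoint_ball
    rw [dist_eq_norm]
    have := h c hc e he hcd
    simp only [δ]; linarith
  have A_subset : A ⊆ ball (0 : EuclideanSpace ℝ (Fin d)) ρ := by
    refine Set.iUnion₂_subset fun x hx => ?_
    apply ball_subset_ball'
    rw [dist_zero_right, hs x hx]
    simp only [δ, ρ]; linarith
  have I : (s.card : ℝ≥0∞) * ENNReal.ofReal (δ ^ d) * μ (ball 0 1) ≤
      ENNReal.ofReal (ρ ^ d) * μ (ball 0 1) :=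
    calc
      (s.card : ℝ≥0∞) * ENNReal.ofReal (δ ^ d) * μ (ball 0 1) = μ A := by
        rw [hA, measure_biUnion_finset D fun c _ => measurableSet_ball]
        simp only [μ.addHaar_ball_of_pos _ δpos, finrank_euclideanSpace, Fintype.card_fin]
        simp only [Finset.sum_const, nsmul_eq_mul, mul_assoc]
      _ ≤ μ (ball 0 ρ) := measure_mono A_subset
      _ = ENNReal.ofReal (ρ ^ d) * μ (ball 0 1) := by
        simp only [μ.addHaar_ball_of_pos _ ρpos, finrank_euclideanSpace, Fintype.card_fin]
  have J : (s.card : ℝ≥0∞) * ENNReal.ofReal (δ ^ d) ≤ ENNReal.ofReal (ρ ^ d) :=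
    (ENNReal.mul_le_mul_iff_left (measure_ball_pos _ _ zero_lt_one).ne' measure_ball_lt_top.ne).1 I
  have K := ENNReal.toReal_le_of_le_ofReal (pow_nonneg ρpos.le _) J
  rw [ENNReal.toReal_mul, ENNReal.toReal_natCast, ENNReal.toReal_ofReal (by positivity)] at K
  have : (1 + 2 / ε) ^ d = ρ ^ d / δ ^ d := by
    rw [← div_pow]; congr 1; simp only [ρ, δ]; field_simp; ring
  rw [this, le_div_iff₀ (by positivity)]
  exact K

lemma ua_net (d : ℕ) {ε : ℝ} (hε : 0 < ε) : ∃ s : Finset (EuclideanSpace ℝ (Fin d)),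
    (∀ c ∈ s, ‖c‖ = 1) ∧ (s.card : ℝ) ≤ (1 + 2 / ε) ^ d ∧
    ∀ z : EuclideanSpace ℝ (Fin d), ‖z‖ = 1 → ∃ c ∈ s, ‖z - c‖ ≤ ε := by
  let P : Finset (EuclideanSpace ℝ (Fin d)) → Prop := fun s =>
    (∀ c ∈ s, ‖c‖ = 1) ∧ (∀ c ∈ s, ∀ e ∈ s, c ≠ e → ε ≤ ‖c - e‖)
  let T : Set ℕ := {n | ∃ s, P s ∧ s.card = n}
  have hne : T.Nonempty := ⟨0, ∅, by simp [P], rfl⟩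
  have hb : BddAbove T := by
    refine ⟨⌊(1 + 2 / ε) ^ d⌋₊, ?_⟩
    rintro n ⟨s, hs, rfl⟩
    exact Nat.le_floor (ua_card_sep hε s hs.1 hs.2)
  obtain ⟨s, hs, hcard⟩ := Nat.sSup_mem hne hb
  refine ⟨s, hs.1, ua_card_sep hε s hs.1 hs.2, ?_⟩
  intro z hz
  by_contra! hcon
  have hzs : z ∉ s := fun h => by
    have := hcon z h
    simp at this; linarith
  have : P (insert z s) := by
    constructor
    · intro c hc
      rcases Finset.mem_insert.1 hc with rfl | hc
      · exact hz
      · exact hs.1 c hc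
    · intro c hc e he hne
      rcases Finset.mem_insert.1 hc with hc1 | hc1 <;>
        rcases Finset.mem_insert.1 he with he1 | he1
      · exact absurd (hc1.trans he1.symm) hne
      · rw [hc1]; exact (hcon e he1).le
      · rw [norm_sub_rev, he1]; exact (hcon c hc1).le
      · exact hs.2 c hc1 e he1 hne
  have h2 : (insert z s).card ≤ sSup T := le_csSup hb ⟨_, this, rfl⟩
  rw [Finset.card_insert_of_notMem hzs, hcard] at h2
  omega

lemma ua_chernoff {E : Type*} [MeasurableSpace E] (μ : Measure E) [IsProbabilityMeasure μ] (m : ℕ)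
    (f : E → ℝ) (hf0 : ∀ a, 0 ≤ f a) (hf : Integrable f μ) {I : ℝ} (hI : ∫ a, f a ∂μ ≤ I)  :
    (Measure.pi fun _ : Fin m => μ) {a | 1 ≤ ∏ i, f (a i)} ≤ ENNReal.ofReal (I ^ m) := by
  have h1 := mul_meas_ge_le_integral_of_nonneg (μ := Measure.pi fun _ : Fin m => μ)
    (f := fun a => ∏ i, f (a i)) (ae_of_all _ fun a => Finset.prod_nonneg fun i _ => hf0 _)
    (Integrable.fintype_prod (f := fun _ => f) fun _ => hf) 1
  rw [integral_fintype_prod_eq_pow, one_mul, Fintype.card_fin] at h1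
  have h2 : (∫ a, f a ∂μ) ^ m ≤ I ^ m := pow_le_pow_left₀ (integral_nonneg hf0) hI m
  rw [← ENNReal.ofReal_toReal (measure_ne_top (Measure.pi fun _ : Fin m => μ)
    {a : Fin m → E | 1 ≤ ∏ i, f (a i)})]
  exact ENNReal.ofReal_le_ofReal (h1.trans h2)

lemma ua_std_eq (d : ℕ) : _root_.stdGaussian d =
    ProbabilityTheory.stdGaussian (EuclideanSpace ℝ (Fin d)) := by
  rw [← map_pi_eq_stdGaussian]; rfl

lemma ua_gauss_pair (d : ℕ) (u v : EuclideanSpace ℝ (Fin d)) :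
    HasGaussianLaw (fun a : EuclideanSpace ℝ (Fin d) => (⟪a, u⟫, ⟪a, v⟫)) (_root_.stdGaussian d) := by
  rw [ua_std_eq]
  have := (IsGaussian.hasGaussianLaw_id (μ := ProbabilityTheory.stdGaussian
    (EuclideanSpace ℝ (Fin d)))).map_fun ((innerSL ℝ u).prod (innerSL ℝ v))
  refine this.congr (ae_of_all _ fun a => ?_)
  simp [real_inner_comm]

lemma ua_law1 (d : ℕ) (u : EuclideanSpace ℝ (Fin d)) :
    (_root_.stdGaussian d).map (fun a => ⟪a, u⟫) = gaussianReal 0 (‖u‖₊ ^ 2) := by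
  have h := (ua_gauss_pair d u u).fst
  rw [h.map_eq_gaussianReal, ua_std_eq]
  have e : (fun a : EuclideanSpace ℝ (Fin d) => ⟪a, u⟫) = (innerSL ℝ u : EuclideanSpace ℝ (Fin d) → ℝ) := by
    ext a; simp [real_inner_comm]
  rw [e, integral_strongDual_stdGaussian, variance_dual_stdGaussian]
  congr 1
  ext
  simp [innerSL_apply_norm]

lemma ua_law2 (d : ℕ) (u v : EuclideanSpace ℝ (Fin d)) (huv : ⟪u, v⟫ = 0) :
    (_root_.stdGaussian d).map (fun a => (⟪a, u⟫, ⟪a, v⟫)) =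
      (gaussianReal 0 (‖u‖₊ ^ 2)).prod (gaussianReal 0 (‖v‖₊ ^ 2)) := by
  have h := ua_gauss_pair d u v
  have hi : IndepFun (fun a => ⟪a, u⟫) (fun a => ⟪a, v⟫) (_root_.stdGaussian d) := by
    apply h.indepFun_of_covariance_eq_zero
    rw [ua_std_eq]
    have := covarianceBilin_apply_eq_cov (μ := ProbabilityTheory.stdGaussian
      (EuclideanSpace ℝ (Fin d))) IsGaussian.memLp_two_id u v
    rw [covarianceBilin_stdGaussian] at this
    have h0 : innerSL ℝ u v = 0 := by rw [innerSL_apply_apply]; exact huv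
    rw [h0] at this
    rw [this]; simp only [real_inner_comm]
  have : IsProbabilityMeasure (_root_.stdGaussian d) := by rw [ua_std_eq]; infer_instance
  rw [(indepFun_iff_map_prod_eq_prod_map_map h.fst.aemeasurable h.snd.aemeasurable).1 hi, ua_law1, ua_law1]

end aux

section auxB
open Set

lemma ua_pdf (x : ℝ) : gaussianPDFReal 0 1 x = (√(2 * π))⁻¹ * rexp (-(1/2) * x ^ 2) := by
  simp [gaussianPDFReal]; left; ring

lemma ua_mgf_sq : ∫ x, rexp (x ^ 2 / 4) ∂(gaussianReal 0 1) = √2 := by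
  rw [integral_gaussianReal_eq_integral_smul one_ne_zero]
  have : ∀ x : ℝ, gaussianPDFReal 0 1 x • rexp (x ^ 2 / 4)
      = (√(2 * π))⁻¹ * rexp (-(1/4) * x ^ 2) := by
    intro x
    rw [ua_pdf, smul_eq_mul, mul_assoc, ← Real.exp_add]
    congr 2; ring
  simp_rw [this]
  rw [integral_const_mul, integral_gaussian, ← Real.sqrt_inv, ← Real.sqrt_mul (by positivity)]
  congr 1
  field_simp
  norm_num

lemma ua_mgf_sq_int : Integrable (fun x => rexp (x ^ 2 / 4)) (gaussianReal 0 1) := by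
  by_contra h
  have := ua_mgf_sq
  rw [integral_undef h] at this
  have h2 : 0 < √(2:ℝ) := by positivity
  linarith

lemma ua_abs_std : ∫ x, |x| ∂(gaussianReal 0 1) = (√(2 * π))⁻¹ * 2 := by
  rw [integral_gaussianReal_eq_integral_smul one_ne_zero]
  have : ∀ x : ℝ, gaussianPDFReal 0 1 x • |x|
      = (√(2 * π))⁻¹ * ((fun y => y * rexp (-(1/2) * y ^ 2)) |x|) := by
    intro x
    rw [ua_pdf, smul_eq_mul]; simp only [sq_abs]; ring
  simp_rw [this]
  rw [integral_const_mul, integral_comp_abs (f := fun y => y * rexp (-(1/2) * y ^ 2))]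
  have h := integral_mul_cexp_neg_mul_sq (b := (1/2 : ℂ)) (by norm_num)
  have h2 : ∫ r : ℝ in Ioi 0, r * rexp (-(1/2) * r ^ 2) = 1 := by
    apply Complex.ofReal_injective
    rw [← integral_complex_ofReal]
    push_cast
    rw [h]; norm_num
  rw [h2]; norm_num

lemma ua_sqrt2pi_lt : √(2 * π) < 2.507 := by
  rw [Real.sqrt_lt' (by norm_num)]
  have := Real.pi_lt_d6
  nlinarith

lemma ua_abs (w : NNReal) : 2 / 3 * √w ≤ ∫ y, |y| ∂(gaussianReal 0 w) := by
  have h := gaussianReal_map_const_mul (μ := 0) (v := 1) (√w)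
  have e : gaussianReal 0 w = (gaussianReal 0 1).map (fun x => √w * x) := by
    rw [show (fun x => √(w:ℝ) * x) = (√(w:ℝ) * ·) from rfl, h]
    congr 1
    · simp
    · ext; simp
  rw [e, integral_map (by fun_prop) (by fun_prop)]
  simp_rw [abs_mul]
  rw [integral_const_mul, ua_abs_std, abs_of_nonneg (Real.sqrt_nonneg _), mul_comm]
  apply mul_le_mul_of_nonneg_left _ (Real.sqrt_nonneg _)
  have := ua_sqrt2pi_lt
  have h0 : 0 < √(2 * π) := by positivity
  rw [inv_mul_eq_div, le_div_iff₀ h0]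
  linarith

lemma ua_int_id (w : NNReal) : Integrable (fun y : ℝ => y) (gaussianReal 0 w) :=
  (memLp_one_iff_integrable.1 (memLp_id_gaussianReal' 1 (by simp)))

lemma ua_int_sq (w : NNReal) : Integrable (fun y : ℝ => y ^ 2) (gaussianReal 0 w) :=
  (memLp_id_gaussianReal' (μ := 0) (v := w) 2 (by simp)).integrable_sq

lemma ua_sq (w : NNReal) : ∫ y, y ^ 2 ∂(gaussianReal 0 w) = w := by
  have h := variance_fun_id_gaussianReal (μ := 0) (v := w)
  rw [variance_of_integral_eq_zero (by fun_prop) (by simp)] at h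
  exact h

lemma ua_shift_sq (w : NNReal) (c : ℝ) : ∫ y, (c + y) ^ 2 ∂(gaussianReal 0 w) = c ^ 2 + w := by
  have : ∀ y : ℝ, (c + y) ^ 2 = c ^ 2 + (2 * c) * y + y ^ 2 := by intro y; ring
  simp_rw [this]
  have i1 := (ua_int_id w).const_mul (2 * c)
  have i2 : Integrable (fun y : ℝ => c ^ 2 + 2 * c * y) (gaussianReal 0 w) :=
    (integrable_const _).add i1
  rw [integral_add i2 (ua_int_sq w), integral_add (integrable_const _) i1,
    integral_const_mul, integral_id_gaussianReal, ua_sq]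
  simp

lemma ua_shift_abs (w : NNReal) {α x : ℝ} (h : α ^ 2 + w = 1) (hx0 : 0 ≤ x) (hx : x ≤ 2 / 3) :
    0.7 * x ≤ ∫ y, |α * x + y| ∂(gaussianReal 0 w) := by
  have ii : ∀ c : ℝ, Integrable (fun y => |c + y|) (gaussianReal 0 w) :=
    fun c => ((integrable_const c).add (ua_int_id w)).abs
  by_cases ha : 0.7 ≤ |α|
  · have h1 : |∫ y, (α * x + y) ∂(gaussianReal 0 w)| ≤ ∫ y, |α * x + y| ∂(gaussianReal 0 w) :=
      abs_integral_le_integral_abs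
    rw [integral_add (integrable_const _) (ua_int_id w), integral_id_gaussianReal] at h1
    simp only [integral_const, probReal_univ, one_smul, add_zero, abs_mul, abs_of_nonneg hx0] at h1
    nlinarith
  · push Not at ha
    have h2 : α ^ 2 ≤ 0.49 := by rw [← sq_abs]; nlinarith [abs_nonneg α]
    have h3 : 0.7 ≤ √(w:ℝ) := Real.le_sqrt_of_sq_le (by norm_num at *; linarith)
    have h4 := ua_abs w
    have h5 : ∫ y, |α * x + y| ∂(gaussianReal 0 w) = ∫ y, |α * x + -y| ∂(gaussianReal 0 w) := by
      have e : gaussianReal 0 w = (gaussianReal 0 w).map (fun y => -y) := by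
        rw [gaussianReal_map_neg]; simp
      conv_lhs => rw [e]
      rw [integral_map (by fun_prop) (by fun_prop)]
    have h6 : Integrable (fun y => |α * x + -y|) (gaussianReal 0 w) :=
      ((integrable_const _).add (ua_int_id w).neg).abs
    have h7 : ∫ y, 2 * |y| ∂(gaussianReal 0 w) ≤
        ∫ y, (|α * x + y| + |α * x + -y|) ∂(gaussianReal 0 w) := by
      refine integral_mono ((ua_int_id w).abs.const_mul 2) ((ii _).add h6) fun y => ?_
      have := abs_sub (α * x + y) (α * x + -y)
      have e : (α * x + y) - (α * x + -y) = 2 * y := by ring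
      rw [e, abs_mul, abs_two] at this
      exact this
    rw [integral_add (ii _) h6, ← h5, integral_const_mul] at h7
    nlinarith

/-- the bump -/
def uaPsi (S t : ℝ) : ℝ := max 0 (S * t * (2 - S * t) / 4)

lemma uaPsi_nonneg (S t : ℝ) : 0 ≤ uaPsi S t := le_max_left _ _
lemma uaPsi_le (S t : ℝ) : uaPsi S t ≤ 1 / 4 :=
  max_le (by norm_num) (by nlinarith [sq_nonneg (S * t - 1)])
lemma uaPsi_cont (S : ℝ) : Continuous (uaPsi S) := by unfold uaPsi; fun_prop
lemma uaPsi_zero {S t : ℝ} (hS : 0 < S) (h : t ∉ Icc 0 (2 / S)) : uaPsi S t = 0 := by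
  apply max_eq_left
  rw [mem_Icc, not_and_or, not_le, not_le] at h
  rcases h with h | h
  · have : S * t < 0 := mul_neg_of_pos_of_neg hS h
    nlinarith
  · rw [div_lt_iff₀ hS] at h
    nlinarith
lemma uaPsi_eq {S t : ℝ} (hS : 0 < S) (h : t ∈ Icc 0 (2 / S)) :
    uaPsi S t = S * t * (2 - S * t) / 4 := by
  apply max_eq_right
  obtain ⟨h1, h2⟩ := h
  rw [le_div_iff₀ hS] at h2
  have : 0 ≤ S * t := by positivity
  nlinarith
lemma uaPsi_le_exp {S t : ℝ} : uaPsi S t ≤ rexp (-(S * t)) := by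
  apply max_le (Real.exp_pos _).le
  set s := S * t
  have h1 : rexp (-(s)) = rexp (-1.5) * rexp (1.5 - s) := by
    rw [← Real.exp_add]; congr 1; ring
  have h2 : 1.5 - s + 1 ≤ rexp (1.5 - s) := Real.add_one_le_exp _
  have h3 : (0.222 : ℝ) ≤ rexp (-1.5) := by
    have e : rexp (-1.5) ^ 2 = (rexp 1 ^ 3)⁻¹ := by
      rw [← Real.exp_nat_mul, ← Real.exp_nat_mul, ← Real.exp_neg]; norm_num
    apply le_of_sq_le_sq _ (Real.exp_pos _).le
    rw [e, le_inv_comm₀ (by norm_num) (by positivity)]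
    calc rexp 1 ^ 3 ≤ 2.7182818286 ^ 3 := by gcongr; exact Real.exp_one_lt_d9.le
      _ ≤ _ := by norm_num
  by_cases hs : s ≤ 2
  · have : 0.222 * (2.5 - s) ≤ rexp (-1.5) * rexp (1.5 - s) := by
      apply mul_le_mul h3 (by linarith) (by linarith) (Real.exp_pos _).le
    rw [h1]
    nlinarith [sq_nonneg (s - 1.444)]
  · have := Real.exp_pos (-s)
    nlinarith
lemma uaPsi_lip {S : ℝ} (hS : 0 < S) (t r : ℝ) : |uaPsi S t - uaPsi S r| ≤ S / 2 * |t - r| := by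
  have key : ∀ t r : ℝ, uaPsi S t - uaPsi S r ≤ S / 2 * |t - r| := by
    intro t r
    have hr0 : 0 ≤ S / 2 * |t - r| := by positivity
    by_cases ht : t ∈ Icc 0 (2 / S)
    · by_cases hr : r ∈ Icc 0 (2 / S)
      · rw [uaPsi_eq hS ht, uaPsi_eq hS hr]
        have e : S * t * (2 - S * t) / 4 - S * r * (2 - S * r) / 4
          = S / 2 * ((t - r) * (1 - (S * t + S * r) / 2)) := by ring
        rw [e]
        apply mul_le_mul_of_nonneg_left _ (by positivity)
        refine (le_abs_self _).trans ?_
        rw [abs_mul]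
        have a1 := (le_div_iff₀ hS).1 ht.2
        have a2 := (le_div_iff₀ hS).1 hr.2
        have a3 : 0 ≤ S * t := mul_nonneg hS.le ht.1
        have a4 : 0 ≤ S * r := mul_nonneg hS.le hr.1
        have : |1 - (S * t + S * r) / 2| ≤ 1 := abs_le.2 ⟨by linarith, by linarith⟩
        nlinarith [abs_nonneg (t - r)]
      · rw [uaPsi_zero hS hr, uaPsi_eq hS ht]
        have a1 := (le_div_iff₀ hS).1 ht.2
        have a3 : 0 ≤ S * t := mul_nonneg hS.le ht.1
        rw [mem_Icc, not_and_or, not_le, not_le] at hr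
        rcases hr with hr | hr
        · have : S * r < 0 := mul_neg_of_pos_of_neg hS hr
          have := mul_le_mul_of_nonneg_left (le_abs_self (t - r)) hS.le
          nlinarith
        · have := (div_lt_iff₀ hS).1 hr
          have := mul_le_mul_of_nonneg_left (neg_le_abs (t - r)) hS.le
          nlinarith
    · rw [uaPsi_zero hS ht]
      have := uaPsi_nonneg S r
      linarith
  rw [abs_sub_le_iff]
  exact ⟨key t r, by rw [abs_sub_comm]; exact key r t⟩

lemma uaPsi_compact {S : ℝ} (hS : 0 < S) : HasCompactSupport (uaPsi S) :=
  HasCompactSupport.intro isCompact_Icc fun _ hx => uaPsi_zero hS hx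

lemma ua_moment1 {S : ℝ} (hS : 3 ≤ S) :
    0.1 / S ^ 2 ≤ ∫ x, uaPsi S x * x ∂(gaussianReal 0 1) := by
  have hS0 : 0 < S := by linarith
  rw [integral_gaussianReal_eq_integral_smul one_ne_zero]
  have hc : Continuous fun x => gaussianPDFReal 0 1 x • (uaPsi S x * x) := by
    simp_rw [ua_pdf]
    have := uaPsi_cont S
    fun_prop
  have hi : Integrable fun x => gaussianPDFReal 0 1 x • (uaPsi S x * x) := by
    apply hc.integrable_of_hasCompactSupport
    exact HasCompactSupport.intro (isCompact_Icc (a := 0) (b := 2 / S))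
      fun x hx => by simp [uaPsi_zero hS0 hx]
  have h0 : ∀ x, 0 ≤ gaussianPDFReal 0 1 x • (uaPsi S x * x) := by
    intro x
    apply smul_nonneg (gaussianPDFReal_nonneg _ _ _)
    by_cases hx : x ∈ Icc 0 (2 / S)
    · exact mul_nonneg (uaPsi_nonneg _ _) hx.1
    · simp [uaPsi_zero hS0 hx]
  have h1 := setIntegral_le_integral (s := Ioc 0 (2 / S)) hi (ae_of_all _ h0)
  refine le_trans ?_ h1
  rw [← intervalIntegral.integral_of_le (by positivity)]
  have h2 : ∫ x in (0:ℝ)..(2 / S), (0.31 * (S / 2) * x ^ 2 - 0.31 * (S ^ 2 / 4) * x ^ 3) ≤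
     ∫ x in (0:ℝ)..(2 / S), gaussianPDFReal 0 1 x • (uaPsi S x * x) := by
    apply intervalIntegral.integral_mono_on (by positivity)
    · exact Continuous.intervalIntegrable (by fun_prop) _ _
    · exact hc.intervalIntegrable _ _
    · intro x hx
      have hpsi := uaPsi_nonneg S x
      have e : 0.31 * (S / 2) * x ^ 2 - 0.31 * (S ^ 2 / 4) * x ^ 3 = 0.31 * (uaPsi S x * x) := by
        rw [uaPsi_eq hS0 hx]; ring
      rw [e, smul_eq_mul]
      apply mul_le_mul_of_nonneg_right _ (mul_nonneg hpsi hx.1)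
      rw [ua_pdf]
      have hx2 : x ≤ 2 / 3 := hx.2.trans (by gcongr)
      have hexp : 7 / 9 ≤ rexp (-(1/2) * x ^ 2) := by
        have := Real.add_one_le_exp (-(1/2) * x ^ 2)
        nlinarith [hx.1]
      have := ua_sqrt2pi_lt
      rw [inv_mul_eq_div, le_div_iff₀ (by positivity)]
      nlinarith
  refine le_trans ?_ h2
  rw [intervalIntegral.integral_sub (Continuous.intervalIntegrable (by fun_prop) _ _)
    (Continuous.intervalIntegrable (by fun_prop) _ _), intervalIntegral.integral_const_mul,
    intervalIntegral.integral_const_mul, integral_pow, integral_pow]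
  have : 0.31 * (S / 2) * (((2 / S) ^ (2 + 1) - 0 ^ (2 + 1)) / ((2:ℕ) + 1)) -
      0.31 * (S ^ 2 / 4) * (((2 / S) ^ (3 + 1) - 0 ^ (3 + 1)) / ((3:ℕ) + 1)) = 0.31 / 3 / S ^ 2 := by
    rw [div_pow, div_pow]; field_simp; norm_num; ring
  rw [this]
  gcongr
  norm_num

lemma ua_moment2 {S : ℝ} (hS : 3 ≤ S) :
    ∫ x, uaPsi S x ^ 2 ∂(gaussianReal 0 1) ≤ 1 / (16 * S) := by
  have hS0 : 0 < S := by linarith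
  rw [integral_gaussianReal_eq_integral_smul one_ne_zero]
  rw [← setIntegral_eq_integral_of_forall_compl_eq_zero (s := Icc 0 (2 / S))
    (fun x hx => by simp [uaPsi_zero hS0 hx])]
  have hc : Continuous fun x => gaussianPDFReal 0 1 x • (uaPsi S x ^ 2) := by
    simp_rw [ua_pdf]
    have := uaPsi_cont S
    fun_prop
  have h : ∫ x in Icc 0 (2 / S), gaussianPDFReal 0 1 x • (uaPsi S x ^ 2) ≤
      ∫ x in Icc 0 (2 / S), (1 / 32 : ℝ) := by
    apply setIntegral_mono_on (hc.continuousOn.integrableOn_Icc)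
      (continuous_const.continuousOn.integrableOn_Icc) measurableSet_Icc
    intro x hx
    have h1 := uaPsi_nonneg S x
    have h2 := uaPsi_le S x
    have h3 : uaPsi S x ^ 2 ≤ 1 / 16 := by nlinarith
    have h4 : gaussianPDFReal 0 1 x ≤ 1 / 2 := by
      rw [ua_pdf]
      have a : rexp (-(1/2) * x ^ 2) ≤ 1 := by
        rw [Real.exp_le_one_iff]; nlinarith [sq_nonneg x]
      have b : 2 ≤ √(2 * π) := Real.le_sqrt_of_sq_le (by nlinarith [Real.pi_gt_three])
      rw [inv_mul_eq_div, div_le_iff₀ (by positivity)]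
      linarith
    have := gaussianPDFReal_nonneg 0 1 x
    rw [smul_eq_mul]
    nlinarith [sq_nonneg (uaPsi S x)]
  refine h.trans ?_
  rw [setIntegral_const, Real.volume_real_Icc_of_le (by positivity)]
  apply le_of_eq
  rw [smul_eq_mul]; field_simp; norm_num

end auxB

section auxC
open Set

instance uaProb (d : ℕ) : IsProbabilityMeasure (_root_.stdGaussian d) := by
  rw [ua_std_eq]; infer_instance

lemma ua_memLp (d : ℕ) (z : EuclideanSpace ℝ (Fin d)) :
    MemLp (fun a => ⟪a, z⟫) 2 (_root_.stdGaussian d) := (ua_gauss_pair d z z).fst.memLp_two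

lemma ua_X_int (d : ℕ) (S : ℝ) (u z : EuclideanSpace ℝ (Fin d)) :
    Integrable (fun a => uaPsi S ⟪a, u⟫ * |⟪a, z⟫|) (_root_.stdGaussian d) := by
  have h := ((ua_memLp d z).integrable (by norm_num)).abs
  have hc := uaPsi_cont S
  refine h.bdd_mul (c := 1 / 4) (by fun_prop) (ae_of_all _ fun a => ?_)
  rw [Real.norm_eq_abs, abs_of_nonneg (uaPsi_nonneg _ _)]
  exact uaPsi_le _ _

lemma ua_X2_int (d : ℕ) (S : ℝ) (u z : EuclideanSpace ℝ (Fin d)) :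
    Integrable (fun a => uaPsi S ⟪a, u⟫ ^ 2 * ⟪a, z⟫ ^ 2) (_root_.stdGaussian d) := by
  have h := (ua_memLp d z).integrable_sq
  have hc := uaPsi_cont S
  refine h.bdd_mul (c := 1 / 16) (by fun_prop) (ae_of_all _ fun a => ?_)
  rw [Real.norm_eq_abs, abs_of_nonneg (sq_nonneg _)]
  nlinarith [uaPsi_le S ⟪a, u⟫, uaPsi_nonneg S ⟪a, u⟫]

lemma ua_decomp {d : ℕ} {u z : EuclideanSpace ℝ (Fin d)} (hu : ‖u‖ = 1) (hz : ‖z‖ = 1) :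
    ∃ (α : ℝ) (v : EuclideanSpace ℝ (Fin d)), ⟪u, v⟫ = 0 ∧ α ^ 2 + ((‖v‖₊ ^ 2 : NNReal) : ℝ) = 1 ∧
      ∀ a : EuclideanSpace ℝ (Fin d), ⟪a, z⟫ = α * ⟪a, u⟫ + ⟪a, v⟫ := by
  have huu : ⟪u, u⟫ = 1 := by rw [real_inner_self_eq_norm_sq, hu]; norm_num
  have hzz : ⟪z, z⟫ = 1 := by rw [real_inner_self_eq_norm_sq, hz]; norm_num
  refine ⟨⟪u, z⟫, z - ⟪u, z⟫ • u, ?_, ?_, ?_⟩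
  · rw [inner_sub_right, inner_smul_right, huu]; ring
  · push_cast
    rw [← real_inner_self_eq_norm_sq, inner_sub_right, inner_sub_left, inner_sub_left,
      inner_smul_right, inner_smul_left, inner_smul_left, inner_smul_right, huu, hzz,
      real_inner_comm u z]
    simp; ring
  · intro a
    rw [inner_sub_right, inner_smul_right]; ring

lemma ua_EX {d : ℕ} {S : ℝ} (hS : 3 ≤ S) {u z : EuclideanSpace ℝ (Fin d)} (hu : ‖u‖ = 1)
    (hz : ‖z‖ = 1) :
    0.07 / S ^ 2 ≤ ∫ a, uaPsi S ⟪a, u⟫ * |⟪a, z⟫| ∂(_root_.stdGaussian d) := by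
  obtain ⟨α, v, h0, h1, h2⟩ := ua_decomp hu hz
  have hS0 : 0 < S := by linarith
  have hc := uaPsi_cont S
  have hi := ua_X_int d S u z
  have hlaw := ua_law2 d u v h0
  have hu1 : ‖u‖₊ ^ 2 = 1 := by ext; simp [hu]
  rw [hu1] at hlaw
  set w := ‖v‖₊ ^ 2
  let G : ℝ × ℝ → ℝ := fun p => uaPsi S p.1 * |α * p.1 + p.2|
  have hG : Continuous G := by fun_prop
  have e : (fun a => uaPsi S ⟪a, u⟫ * |⟪a, z⟫|) = fun a => G (⟪a, u⟫, ⟪a, v⟫) := by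
    ext a; simp only [G, h2]
  have hm : Measurable (fun a : EuclideanSpace ℝ (Fin d) => (⟪a, u⟫, ⟪a, v⟫)) := by fun_prop
  have hGi : Integrable G ((gaussianReal 0 1).prod (gaussianReal 0 w)) := by
    rw [← hlaw, integrable_map_measure hG.aestronglyMeasurable hm.aemeasurable]
    rw [e] at hi; exact hi
  rw [e, ← integral_map (f := G) hm.aemeasurable hG.aestronglyMeasurable, hlaw,
    integral_prod _ hGi]
  have hm1 := ua_moment1 hS
  have hmi : Integrable (fun x => uaPsi S x * x) (gaussianReal 0 1) := by
    refine (ua_int_id 1).bdd_mul (c := 1 / 4) (by fun_prop) (ae_of_all _ fun a => ?_)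
    rw [Real.norm_eq_abs, abs_of_nonneg (uaPsi_nonneg _ _)]
    exact uaPsi_le _ _
  have : ∫ x, 0.7 * (uaPsi S x * x) ∂(gaussianReal 0 1) ≤
      ∫ x, ∫ y, G (x, y) ∂(gaussianReal 0 w) ∂(gaussianReal 0 1) := by
    refine integral_mono (hmi.const_mul _) hGi.integral_prod_left fun x => ?_
    simp only [G]
    rw [integral_const_mul]
    by_cases hx : x ∈ Icc 0 (2 / S)
    · have := ua_shift_abs w h1 hx.1 (hx.2.trans (by gcongr))
      have := mul_le_mul_of_nonneg_left this (uaPsi_nonneg S x)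
      linarith
    · simp [uaPsi_zero hS0 hx]
  rw [integral_const_mul] at this
  refine le_trans ?_ this
  calc 0.07 / S ^ 2 = 0.7 * (0.1 / S ^ 2) := by ring
    _ ≤ _ := by gcongr

lemma ua_EX2 {d : ℕ} {S : ℝ} (hS : 3 ≤ S) {u z : EuclideanSpace ℝ (Fin d)} (hu : ‖u‖ = 1)
    (hz : ‖z‖ = 1) :
    ∫ a, uaPsi S ⟪a, u⟫ ^ 2 * ⟪a, z⟫ ^ 2 ∂(_root_.stdGaussian d) ≤ 1 / (16 * S) := by
  obtain ⟨α, v, h0, h1, h2⟩ := ua_decomp hu hz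
  have hS0 : 0 < S := by linarith
  have hc := uaPsi_cont S
  have hi := ua_X2_int d S u z
  have hlaw := ua_law2 d u v h0
  have hu1 : ‖u‖₊ ^ 2 = 1 := by ext; simp [hu]
  rw [hu1] at hlaw
  set w := ‖v‖₊ ^ 2
  let G : ℝ × ℝ → ℝ := fun p => uaPsi S p.1 ^ 2 * (α * p.1 + p.2) ^ 2
  have hG : Continuous G := by fun_prop
  have e : (fun a => uaPsi S ⟪a, u⟫ ^ 2 * ⟪a, z⟫ ^ 2) = fun a => G (⟪a, u⟫, ⟪a, v⟫) := by
    ext a; simp only [G, h2]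
  have hm : Measurable (fun a : EuclideanSpace ℝ (Fin d) => (⟪a, u⟫, ⟪a, v⟫)) := by fun_prop
  have hGi : Integrable G ((gaussianReal 0 1).prod (gaussianReal 0 w)) := by
    rw [← hlaw, integrable_map_measure hG.aestronglyMeasurable hm.aemeasurable]
    rw [e] at hi; exact hi
  rw [e, ← integral_map (f := G) hm.aemeasurable hG.aestronglyMeasurable, hlaw,
    integral_prod _ hGi]
  refine le_trans ?_ (ua_moment2 hS)
  have hmi : Integrable (fun x => uaPsi S x ^ 2) (gaussianReal 0 1) := by
    refine Integrable.of_bound (C := 1 / 16) (by fun_prop) (ae_of_all _ fun a => ?_)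
    rw [Real.norm_eq_abs, abs_of_nonneg (sq_nonneg _)]
    nlinarith [uaPsi_le S a, uaPsi_nonneg S a]
  refine integral_mono hGi.integral_prod_left hmi fun x => ?_
  simp only [G]
  rw [integral_const_mul, ua_shift_sq]
  by_cases hx : x ∈ Icc 0 (2 / S)
  · have hx1 : x ≤ 1 := (hx.2.trans (by gcongr)).trans (by norm_num : (2:ℝ) / 3 ≤ 1)
    have hx2 : x ^ 2 ≤ 1 := by nlinarith [hx.1]
    have : (α * x) ^ 2 + w ≤ 1 := by
      rw [← h1, mul_pow]; nlinarith [sq_nonneg α]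
    nlinarith [sq_nonneg (uaPsi S x)]
  · simp [uaPsi_zero hS0 hx]

lemma ua_exp_neg_le {x : ℝ} (hx : 0 ≤ x) : rexp (-x) ≤ 1 - x + x ^ 2 / 2 := by
  have h1 : 1 + x + x ^ 2 / 2 ≤ rexp x := Real.quadratic_le_exp_of_nonneg hx
  rw [Real.exp_neg, inv_le_comm₀ (Real.exp_pos _) (by nlinarith [sq_nonneg (x - 1)])]
  refine le_trans ?_ h1
  have h2 : 0 < 1 - x + x ^ 2 / 2 := by nlinarith [sq_nonneg (x - 1)]
  rw [inv_eq_one_div, div_le_iff₀ h2]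
  nlinarith [sq_nonneg (x ^ 2)]

lemma ua_conc {d m : ℕ} {S : ℝ} (hS : 3 ≤ S) {u z : EuclideanSpace ℝ (Fin d)} (hu : ‖u‖ = 1)
    (hz : ‖z‖ = 1) :
    iidGaussian d m {a | ∑ i, uaPsi S ⟪a i, u⟫ * |⟪a i, z⟫| ≤ m * (0.055 / S ^ 2)} ≤
      ENNReal.ofReal (rexp (-(0.0018 / S ^ 3)) ^ m) := by
  have hS0 : 0 < S := by linarith
  have hc := uaPsi_cont S
  set X : EuclideanSpace ℝ (Fin d) → ℝ := fun a => uaPsi S ⟪a, u⟫ * |⟪a, z⟫| with hX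
  have hX0 : ∀ a, 0 ≤ X a := fun a => mul_nonneg (uaPsi_nonneg _ _) (abs_nonneg _)
  set l : ℝ := 0.24 / S with hl
  have hl0 : 0 < l := by positivity
  set t : ℝ := 0.055 / S ^ 2 with ht
  let f : EuclideanSpace ℝ (Fin d) → ℝ := fun a => rexp (l * t) * rexp (-(l * X a))
  have hXc : Continuous X := by fun_prop
  have hei : Integrable (fun a => rexp (-(l * X a))) (_root_.stdGaussian d) := by
    refine Integrable.of_bound (C := 1) (by fun_prop) (ae_of_all _ fun a => ?_)
    rw [Real.norm_eq_abs, abs_of_nonneg (Real.exp_pos _).le, Real.exp_le_one_iff]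
    have := mul_nonneg hl0.le (hX0 a)
    linarith
  have hfi : Integrable f (_root_.stdGaussian d) := hei.const_mul _
  have hI : ∫ a, f a ∂(_root_.stdGaussian d) ≤ rexp (-(0.0018 / S ^ 3)) := by
    have hXi : Integrable X (_root_.stdGaussian d) := ua_X_int d S u z
    have hX2i : Integrable (fun a => X a ^ 2) (_root_.stdGaussian d) := by
      refine (ua_X2_int d S u z).congr (ae_of_all _ fun a => ?_)
      simp only [hX, mul_pow, sq_abs]
    have h1 : ∫ a, rexp (-(l * X a)) ∂(_root_.stdGaussian d) ≤
        ∫ a, ((1 - l * X a) + l ^ 2 / 2 * X a ^ 2) ∂(_root_.stdGaussian d) := by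
      refine integral_mono hei (((integrable_const _).sub (hXi.const_mul _)).add
        (hX2i.const_mul _)) fun a => ?_
      have := ua_exp_neg_le (mul_nonneg hl0.le (hX0 a))
      refine this.trans (le_of_eq ?_)
      ring
    have i1 : Integrable (fun a => 1 - l * X a) (_root_.stdGaussian d) :=
      (integrable_const _).sub (hXi.const_mul _)
    rw [integral_add i1 (hX2i.const_mul _),
      integral_sub (integrable_const _) (hXi.const_mul _), integral_const_mul,
      integral_const_mul] at h1
    have h2 : 0.07 / S ^ 2 ≤ ∫ a, X a ∂(_root_.stdGaussian d) := ua_EX hS hu hz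
    have h3 : ∫ a, X a ^ 2 ∂(_root_.stdGaussian d) ≤ 1 / (16 * S) := by
      refine le_trans (le_of_eq ?_) (ua_EX2 hS hu hz)
      refine integral_congr_ae (ae_of_all _ fun a => ?_)
      simp only [hX, mul_pow, sq_abs]
    have h4 : l * (0.07 / S ^ 2) ≤ l * ∫ a, X a ∂(_root_.stdGaussian d) := by gcongr
    have h5 : l ^ 2 / 2 * ∫ a, X a ^ 2 ∂(_root_.stdGaussian d) ≤ l ^ 2 / 2 * (1 / (16 * S)) := by
      gcongr
    have h6 : ∫ a, rexp (-(l * X a)) ∂(_root_.stdGaussian d) ≤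
        1 + (-(l * (0.07 / S ^ 2)) + l ^ 2 / 2 * (1 / (16 * S))) := by
      simp only [integral_const, probReal_univ, one_smul] at h1
      linarith
    have h7 := Real.add_one_le_exp (-(l * (0.07 / S ^ 2)) + l ^ 2 / 2 * (1 / (16 * S)))
    simp only [f]
    rw [integral_const_mul]
    calc _ ≤ rexp (l * t) * rexp (-(l * (0.07 / S ^ 2)) + l ^ 2 / 2 * (1 / (16 * S))) := by
          gcongr; linarith
      _ = rexp (-(0.0018 / S ^ 3)) := by
          rw [← Real.exp_add]; congr 1
          rw [hl, ht]; field_simp; norm_num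
  have h := ua_chernoff (_root_.stdGaussian d) m f (fun a => by positivity) hfi hI
  refine le_trans (measure_mono ?_) h
  intro a ha
  simp only [mem_ofPred_eq] at ha ⊢
  have : ∏ i, f (a i) = rexp (l * (m * t - ∑ i, X (a i))) := by
    simp only [f]
    rw [Finset.prod_mul_distrib, Finset.prod_const, ← Real.exp_sum, ← Real.exp_nat_mul,
      ← Real.exp_add]
    congr 1
    rw [Finset.sum_neg_distrib, ← Finset.mul_sum]
    simp; ring
  rw [this, Real.one_le_exp_iff]
  apply mul_nonneg hl0.le
  linarith

lemma ua_opconc {d m : ℕ} {v : EuclideanSpace ℝ (Fin d)} (hv : ‖v‖ = 1) :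
    iidGaussian d m {a | m * 4 ≤ ∑ i, ⟪a i, v⟫ ^ 2} ≤
      ENNReal.ofReal (rexp (-(1 / 2)) ^ m) := by
  let f : EuclideanSpace ℝ (Fin d) → ℝ := fun a => rexp (-1) * rexp (⟪a, v⟫ ^ 2 / 4)
  have hlaw := ua_law1 d v
  have hv1 : ‖v‖₊ ^ 2 = 1 := by ext; simp [hv]
  rw [hv1] at hlaw
  have hm : Measurable (fun a : EuclideanSpace ℝ (Fin d) => ⟪a, v⟫) := by fun_prop
  have hei : Integrable (fun a => rexp (⟪a, v⟫ ^ 2 / 4)) (_root_.stdGaussian d) := by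
    have := ua_mgf_sq_int
    rw [← hlaw, integrable_map_measure (by fun_prop) hm.aemeasurable] at this
    exact this
  have hI : ∫ a, f a ∂(_root_.stdGaussian d) ≤ rexp (-(1 / 2)) := by
    simp only [f]
    rw [integral_const_mul]
    have : ∫ a, rexp (⟪a, v⟫ ^ 2 / 4) ∂(_root_.stdGaussian d) = √2 := by
      rw [← ua_mgf_sq, ← hlaw, integral_map hm.aemeasurable (by fun_prop)]
    rw [this]
    have h2 : √2 ≤ rexp (1 / 2) := by
      apply Real.sqrt_le_iff.2 ⟨(Real.exp_pos _).le, ?_⟩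
      rw [← Real.exp_nat_mul]
      have := Real.exp_one_gt_d9
      norm_num
      linarith
    calc _ ≤ rexp (-1) * rexp (1 / 2) := by gcongr
      _ = _ := by rw [← Real.exp_add]; norm_num
  have h := ua_chernoff (_root_.stdGaussian d) m f (fun a => by positivity) (hei.const_mul _) hI
  refine le_trans (measure_mono ?_) h
  intro a ha
  simp only [mem_ofPred_eq] at ha ⊢
  have : ∏ i, f (a i) = rexp (-m + (∑ i, ⟪a i, v⟫ ^ 2) / 4) := by
    simp only [f]
    rw [Finset.prod_mul_distrib, Finset.prod_const, ← Real.exp_sum, ← Real.exp_nat_mul,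
      ← Real.exp_add, Finset.sum_div]
    congr 1
    simp
  rw [this, Real.one_le_exp_iff]
  linarith

end auxC

section auxD
open Set

def uaT {d m : ℕ} (a : Fin m → EuclideanSpace ℝ (Fin d)) :
    EuclideanSpace ℝ (Fin d) →L[ℝ] EuclideanSpace ℝ (Fin m) :=
  LinearMap.toContinuousLinearMap
    { toFun := fun v => WithLp.toLp 2 fun i => ⟪a i, v⟫
      map_add' := fun v w => by ext i; simp [inner_add_right]
      map_smul' := fun c v => by ext i; simp [inner_smul_right] }

lemma uaT_norm {d m : ℕ} (a : Fin m → EuclideanSpace ℝ (Fin d)) (v : EuclideanSpace ℝ (Fin d)) :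
    ‖uaT a v‖ = √(∑ i, ⟪a i, v⟫ ^ 2) := by
  rw [EuclideanSpace.norm_eq]
  simp [uaT]

lemma uaT_op {d m : ℕ} {a : Fin m → EuclideanSpace ℝ (Fin d)}
    {s : Finset (EuclideanSpace ℝ (Fin d))} {ε : ℝ} (hε : ε ≤ 1 / 2)
    (hs : ∀ z : EuclideanSpace ℝ (Fin d), ‖z‖ = 1 → ∃ c ∈ s, ‖z - c‖ ≤ ε)
    (h : ∀ v ∈ s, ∑ i, ⟪a i, v⟫ ^ 2 ≤ m * 4) : ‖uaT a‖ ≤ 4 * √m := by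
  have key : ‖uaT a‖ ≤ 2 * √m + ‖uaT a‖ / 2 := by
    apply ContinuousLinearMap.opNorm_le_of_unit_norm (by positivity)
    intro z hz
    obtain ⟨c, hc, hzc⟩ := hs z hz
    have h1 : ‖uaT a c‖ ≤ 2 * √m := by
      rw [uaT_norm]
      apply Real.sqrt_le_iff.2 ⟨by positivity, ?_⟩
      rw [mul_pow, Real.sq_sqrt (by positivity)]
      linarith [h c hc]
    have h2 : ‖uaT a (z - c)‖ ≤ ‖uaT a‖ * (1 / 2) :=
      (ContinuousLinearMap.le_opNorm _ _).trans (by gcongr; linarith)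
    have h3 : uaT a z = uaT a c + uaT a (z - c) := by rw [← map_add]; congr 1; abel
    rw [h3]
    refine (norm_add_le _ _).trans ?_
    linarith
  linarith

lemma uaT_mul {d m : ℕ} (a : Fin m → EuclideanSpace ℝ (Fin d)) (x y : EuclideanSpace ℝ (Fin d))
    (h : ‖uaT a‖ ≤ 4 * √m) :
    ∑ i, |⟪a i, x⟫| * |⟪a i, y⟫| ≤ 16 * m * ‖x‖ * ‖y‖ := by
  have h1 := Real.sum_mul_le_sqrt_mul_sqrt Finset.univ (fun i => |⟪a i, x⟫|) (fun i => |⟪a i, y⟫|)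
  simp only [sq_abs] at h1
  rw [← uaT_norm, ← uaT_norm] at h1
  refine h1.trans ?_
  have hx : ‖uaT a x‖ ≤ 4 * √m * ‖x‖ := (ContinuousLinearMap.le_opNorm _ _).trans (by gcongr)
  have hy : ‖uaT a y‖ ≤ 4 * √m * ‖y‖ := (ContinuousLinearMap.le_opNorm _ _).trans (by gcongr)
  calc _ ≤ (4 * √m * ‖x‖) * (4 * √m * ‖y‖) := by gcongr
    _ = 16 * (√m * √m) * ‖x‖ * ‖y‖ := by ring
    _ = _ := by rw [Real.mul_self_sqrt (by positivity)]

lemma uaT_abs {d m : ℕ} (a : Fin m → EuclideanSpace ℝ (Fin d)) (x : EuclideanSpace ℝ (Fin d))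
    (h : ‖uaT a‖ ≤ 4 * √m) :
    ∑ i, |⟪a i, x⟫| ≤ 4 * m * ‖x‖ := by
  have h1 := Real.sum_mul_le_sqrt_mul_sqrt Finset.univ (fun i => |⟪a i, x⟫|) (fun _ => 1)
  simp only [sq_abs, mul_one] at h1
  rw [← uaT_norm] at h1
  refine h1.trans ?_
  have hx : ‖uaT a x‖ ≤ 4 * √m * ‖x‖ := (ContinuousLinearMap.le_opNorm _ _).trans (by gcongr)
  simp only [one_pow, Finset.sum_const, Finset.card_univ, Fintype.card_fin, nsmul_eq_mul, mul_one]
  calc _ ≤ (4 * √m * ‖x‖) * √m := by gcongr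
    _ = 4 * (√m * √m) * ‖x‖ := by ring
    _ = _ := by rw [Real.mul_self_sqrt (by positivity)]

lemma ua_unif {d m : ℕ} {S : ℝ} (hS : 3 ≤ S) {a : Fin m → EuclideanSpace ℝ (Fin d)}
    {s : Finset (EuclideanSpace ℝ (Fin d))} (hs1 : ∀ c ∈ s, ‖c‖ = 1)
    (hs : ∀ z : EuclideanSpace ℝ (Fin d), ‖z‖ = 1 → ∃ c ∈ s, ‖z - c‖ ≤ 0.001 / S ^ 3)
    (h : ∀ v ∈ s, ∑ i, ⟪a i, v⟫ ^ 2 ≤ m * 4)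
    (hF : ∀ u ∈ s, ∀ z ∈ s, m * (0.055 / S ^ 2) ≤ ∑ i, uaPsi S ⟪a i, u⟫ * |⟪a i, z⟫|)
    {u z : EuclideanSpace ℝ (Fin d)} (hu : ‖u‖ = 1) (hz : ‖z‖ = 1) :
    m * (0.046 / S ^ 2) ≤ ∑ i, uaPsi S ⟪a i, u⟫ * |⟪a i, z⟫| := by
  have hS0 : 0 < S := by linarith
  have hS3 : (27:ℝ) ≤ S ^ 3 := by
    calc (27:ℝ) = 3 ^ 3 := by norm_num
      _ ≤ S ^ 3 := by gcongr
  set ε := 0.001 / S ^ 3 with hε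
  have hε0 : 0 < ε := by positivity
  have hε2 : ε ≤ 1 / 2 := by
    rw [hε, div_le_iff₀ (by positivity)]; linarith
  have hT := uaT_op hε2 hs h
  obtain ⟨c, hc, huc⟩ := hs u hu
  obtain ⟨e, he, hze⟩ := hs z hz
  have h1 := hF c hc e he
  have h2 : ∑ i, uaPsi S ⟪a i, c⟫ * |⟪a i, e⟫| ≤ ∑ i, (uaPsi S ⟪a i, u⟫ * |⟪a i, z⟫| +
      (S / 2 * (|⟪a i, u - c⟫| * |⟪a i, e⟫|) + 1 / 4 * |⟪a i, z - e⟫|)) := by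
    apply Finset.sum_le_sum
    intro i _
    have b1 := uaPsi_lip hS0 ⟪a i, c⟫ ⟪a i, u⟫
    rw [abs_sub_comm ⟪a i, c⟫, ← inner_sub_right] at b1
    have b2 := (le_abs_self _).trans b1
    have b3 : |⟪a i, e⟫| ≤ |⟪a i, z⟫| + |⟪a i, z - e⟫| := by
      rw [inner_sub_right, abs_sub_comm]
      have := abs_add_le ⟪a i, z⟫ (⟪a i, e⟫ - ⟪a i, z⟫)
      simpa using this
    have b4 := uaPsi_nonneg S ⟪a i, u⟫
    have b5 := uaPsi_le S ⟪a i, u⟫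
    have b6 := mul_le_mul_of_nonneg_right b2 (abs_nonneg ⟪a i, e⟫)
    have b7 := mul_le_mul_of_nonneg_left b3 b4
    have b8 := mul_le_mul_of_nonneg_right b5 (abs_nonneg ⟪a i, z - e⟫)
    nlinarith
  rw [Finset.sum_add_distrib, Finset.sum_add_distrib, ← Finset.mul_sum, ← Finset.mul_sum] at h2
  have h3 := uaT_mul a (u - c) e hT
  have h4 := uaT_abs a (z - e) hT
  rw [hs1 e he, mul_one] at h3
  have h5 : 16 * (m:ℝ) * ‖u - c‖ ≤ 16 * m * ε := by gcongr
  have h6 : 4 * (m:ℝ) * ‖z - e‖ ≤ 4 * m * ε := by gcongr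
  have h7 : S / 2 * ∑ i, |⟪a i, u - c⟫| * |⟪a i, e⟫| ≤ S / 2 * (16 * m * ε) := by
    gcongr; exact h3.trans h5
  have h8 : S / 2 * (16 * m * ε) + 1 / 4 * (4 * m * ε) ≤ m * (0.009 / S ^ 2) := by
    have e1 : m * (0.009 / S ^ 2) = 9 * S * m * ε := by
      rw [hε]; field_simp; norm_num; ring
    rw [e1]
    have : 0 ≤ (m:ℝ) * ε := by positivity
    nlinarith
  have h9 : (m:ℝ) * (0.055 / S ^ 2) = m * (0.046 / S ^ 2) + m * (0.009 / S ^ 2) := by ring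
  linarith

lemma ua_numeric {R : ℝ} (hR : 1 ≤ R) :
    1 / (4 * √π * (1 + 9 * π * R ^ 2)) ≤ 0.046 / (3 * R) ^ 2 := by
  have hp : 1.77 ≤ √π := Real.le_sqrt_of_sq_le (by have := Real.pi_gt_d6; norm_num at *; linarith)
  have hp2 := Real.pi_gt_d6
  have : (5.55 : ℝ) ≤ √π * π := by nlinarith
  rw [div_le_div_iff₀ (by positivity) (by positivity)]
  have h2 : 0 < R ^ 2 := by positivity
  have h3 : 0 ≤ √π := by positivity
  nlinarith [mul_le_mul_of_nonneg_right this h2.le]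

lemma ua_subgrad {d m : ℕ} (xstar : EuclideanSpace ℝ (Fin d))
    (a : Fin m → EuclideanSpace ℝ (Fin d)) (x : EuclideanSpace ℝ (Fin d)) :
    (1 / m) * ∑ i, Real.exp (-⟪a i, x⟫) * |⟪a i, x - xstar⟫| *
                  (if 0 < ⟪a i, x⟫ then (1 : ℝ) else 0) ≤ ⟪subgrad xstar a x, x - xstar⟫ := by
  unfold subgrad
  rw [inner_neg_left, inner_smul_left, sum_inner, ← mul_neg, ← Finset.sum_neg_distrib]
  simp only [conj_trivial]
  apply mul_le_mul_of_nonneg_left _ (by positivity)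
  apply Finset.sum_le_sum
  intro i _
  rw [inner_smul_left, inner_sub_right]
  simp only [conj_trivial]
  set p := ⟪a i, x⟫
  set q := ⟪a i, xstar⟫
  have e : (1 - rexp (-max q 0)) - (1 - rexp (-max p 0)) = rexp (-max p 0) - rexp (-max q 0) := by
    ring
  rw [e]
  rcases lt_trichotomy 0 p with hp | hp | hp
  · rw [if_pos hp, max_eq_left hp.le]
    unfold indNonneg
    rw [if_pos hp.le]
    have hE := Real.exp_pos (-p)
    rcases lt_trichotomy p q with h | h | h
    · have h1 : 0 < rexp (-p) - rexp (-max q 0) := by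
        rw [sub_pos, Real.exp_lt_exp, neg_lt_neg_iff]; exact lt_max_of_lt_left h
      unfold sgn0
      rw [if_pos h1, abs_of_neg (by linarith)]
      apply le_of_eq; ring
    · rw [h]; simp
    · have h1 : rexp (-p) - rexp (-max q 0) < 0 := by
        rw [sub_neg, Real.exp_lt_exp, neg_lt_neg_iff]; exact max_lt h hp
      unfold sgn0
      rw [if_neg h1.le.not_gt, if_pos h1, abs_of_pos (by linarith)]
      apply le_of_eq; ring
  · rw [if_neg (by linarith), ← hp]
    simp only [max_self, neg_zero, Real.exp_zero, mul_zero, mul_one, zero_sub]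
    unfold indNonneg sgn0
    rw [if_pos le_rfl]
    by_cases hq : 0 < q
    · rw [max_eq_left hq.le]
      have : 0 < 1 - rexp (-q) := by
        rw [sub_pos, Real.exp_lt_one_iff]; linarith
      rw [if_pos this]; linarith
    · rw [max_eq_right (not_lt.1 hq)]; simp
  · rw [if_neg (by linarith)]
    unfold indNonneg
    rw [if_neg (by linarith)]
    simp

lemma ua_point {d m : ℕ} (hm : 1 ≤ m) {xstar : EuclideanSpace ℝ (Fin d)} (hR : 1 ≤ ‖xstar‖)
    {a : Fin m → EuclideanSpace ℝ (Fin d)}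
    (h : ∀ u z : EuclideanSpace ℝ (Fin d), ‖u‖ = 1 → ‖z‖ = 1 →
      m * (0.046 / (3 * ‖xstar‖) ^ 2) ≤ ∑ i, uaPsi (3 * ‖xstar‖) ⟪a i, u⟫ * |⟪a i, z⟫|)
    {x : EuclideanSpace ℝ (Fin d)} (hx0 : 0 < ‖x‖) (hx : ‖x‖ ≤ 3 * ‖xstar‖) :
    ‖x - xstar‖ / (4 * Real.sqrt π * (1 + 9 * π * ‖xstar‖ ^ 2)) ≤
                (1 / m) * ∑ i, Real.exp (-⟪a i, x⟫) * |⟪a i, x - xstar⟫| *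
                  (if 0 < ⟪a i, x⟫ then (1 : ℝ) else 0) := by
  have hm0 : (0:ℝ) < m := by exact_mod_cast hm
  by_cases hxx : x - xstar = 0
  · simp [hxx]
  have hn : 0 < ‖x - xstar‖ := norm_pos_iff.2 hxx
  set S := 3 * ‖xstar‖ with hSdef
  have hS0 : 0 < S := by positivity
  set D := ‖x - xstar‖ with hD
  let u := ‖x‖⁻¹ • x
  let z := D⁻¹ • (x - xstar)
  have hu : ‖u‖ = 1 := by simp only [u, norm_smul, norm_inv, norm_norm]; field_simp
  have hz : ‖z‖ = 1 := by
    simp only [z, norm_smul, norm_inv, ← hD, Real.norm_eq_abs, abs_of_pos hn]; field_simp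
  have h1 := h u z hu hz
  have h2 : D * ∑ i, uaPsi S ⟪a i, u⟫ * |⟪a i, z⟫| ≤
      ∑ i, Real.exp (-⟪a i, x⟫) * |⟪a i, x - xstar⟫| *
                  (if 0 < ⟪a i, x⟫ then (1 : ℝ) else 0) := by
    rw [Finset.mul_sum]
    apply Finset.sum_le_sum
    intro i _
    have e1 : |⟪a i, x - xstar⟫| = D * |⟪a i, z⟫| := by
      simp only [z, inner_smul_right, abs_mul, abs_inv, abs_of_pos hn]; field_simp
    have e2 : ⟪a i, x⟫ = ‖x‖ * ⟪a i, u⟫ := by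
      simp only [u, inner_smul_right]; field_simp
    rw [e1]
    by_cases hp : 0 < ⟪a i, x⟫
    · rw [if_pos hp, mul_one]
      have hup : 0 < ⟪a i, u⟫ := by
        rw [e2] at hp; exact pos_of_mul_pos_right hp hx0.le
      have b1 : uaPsi S ⟪a i, u⟫ ≤ rexp (-⟪a i, x⟫) := by
        refine uaPsi_le_exp.trans ?_
        rw [e2, Real.exp_le_exp]
        have := mul_le_mul_of_nonneg_right hx hup.le
        linarith
      have b2 : 0 ≤ D * |⟪a i, z⟫| := by positivity
      calc _ = uaPsi S ⟪a i, u⟫ * (D * |⟪a i, z⟫|) := by ring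
        _ ≤ _ := mul_le_mul_of_nonneg_right b1 b2
    · rw [if_neg hp, mul_zero]
      have hup : ⟪a i, u⟫ ≤ 0 := by
        by_contra hcon
        push Not at hcon
        apply hp; rw [e2]; positivity
      have : uaPsi S ⟪a i, u⟫ = 0 := by
        apply max_eq_left
        have : S * ⟪a i, u⟫ ≤ 0 := mul_nonpos_of_nonneg_of_nonpos hS0.le hup
        nlinarith
      rw [this]; simp
  calc D / (4 * Real.sqrt π * (1 + 9 * π * ‖xstar‖ ^ 2))
      = D * (1 / (4 * Real.sqrt π * (1 + 9 * π * ‖xstar‖ ^ 2))) := by ring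
    _ ≤ D * (0.046 / S ^ 2) := by
        apply mul_le_mul_of_nonneg_left (ua_numeric hR) hn.le
    _ = (1 / m) * (D * (m * (0.046 / S ^ 2))) := by field_simp
    _ ≤ (1 / m) * (D * ∑ i, uaPsi S ⟪a i, u⟫ * |⟪a i, z⟫|) := by gcongr
    _ ≤ _ := by gcongr

lemma ua_netcard {S : ℝ} (hS : 3 ≤ S) : 1 + 2 / (0.001 / S ^ 3) ≤ rexp (6 * S) := by
  have hS0 : 0 < S := by linarith
  have h1 : S ≤ rexp S := by linarith [Real.add_one_le_exp S]
  have h2 : S ^ 3 ≤ rexp (3 * S) := by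
    calc S ^ 3 ≤ rexp S ^ 3 := by gcongr
      _ = _ := by rw [← Real.exp_nat_mul]; norm_num
  have h3 : 2001 ≤ rexp (3 * S) := by
    calc (2001:ℝ) ≤ 2.7 ^ 9 := by norm_num
      _ ≤ rexp 1 ^ 9 := by gcongr; linarith [Real.exp_one_gt_d9]
      _ = rexp 9 := by rw [← Real.exp_nat_mul]; norm_num
      _ ≤ _ := by rw [Real.exp_le_exp]; linarith
  have h4 : (1:ℝ) ≤ S ^ 3 := one_le_pow₀ (by linarith)
  calc 1 + 2 / (0.001 / S ^ 3) = 1 + 2000 * S ^ 3 := by field_simp; norm_num; ring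
    _ ≤ 2001 * S ^ 3 := by linarith
    _ ≤ rexp (3 * S) * rexp (3 * S) := by gcongr
    _ = _ := by rw [← Real.exp_add]; ring_nf

end auxD


/-- Uniform aiming inequality: there exists a universal constant `C > 0` such that if
`‖x⋆‖ ≥ 1` and `m ≥ C d ‖x⋆‖⁴`, then with probability at least `1 - 2 exp(-d)`,
simultaneously for all `x` with `0 < ‖x‖ ≤ 3‖x⋆‖` the empirical aiming sum and
`⟨g(x), x - x⋆⟩` are bounded below by `‖x - x⋆‖/(4√π(1 + 9π‖x⋆‖²))`. -/
theorem uniform_aiming :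
    ∃ C : ℝ, 0 < C ∧
      ∀ (d m : ℕ) (xstar : EuclideanSpace ℝ (Fin d)), 1 ≤ d → 1 ≤ m →
        1 ≤ ‖xstar‖ → C * d * ‖xstar‖ ^ 4 ≤ m →
        ENNReal.ofReal (1 - 2 * Real.exp (-(d : ℝ))) ≤
          iidGaussian d m {a |
            ∀ x : EuclideanSpace ℝ (Fin d), 0 < ‖x‖ → ‖x‖ ≤ 3 * ‖xstar‖ →
              ‖x - xstar‖ / (4 * Real.sqrt π * (1 + 9 * π * ‖xstar‖ ^ 2)) ≤
                (1 / m) * ∑ i, Real.exp (-⟪a i, x⟫) * |⟪a i, x - xstar⟫| *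
                  (if 0 < ⟪a i, x⟫ then (1 : ℝ) else 0) ∧
              ‖x - xstar‖ / (4 * Real.sqrt π * (1 + 9 * π * ‖xstar‖ ^ 2)) ≤
                ⟪subgrad xstar a x, x - xstar⟫} := by

  refine ⟨1000000, by norm_num, ?_⟩
  intro d m xstar hd hm hR hC
  set S := 3 * ‖xstar‖ with hSdef
  have hS : 3 ≤ S := by linarith
  have hS0 : 0 < S := by linarith
  have hd1 : (1:ℝ) ≤ d := by exact_mod_cast hd
  obtain ⟨s, hs1, hcard, hs⟩ := ua_net d (ε := 0.001 / S ^ 3) (by positivity)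
  have hN : (s.card : ℝ) ≤ rexp (6 * d * S) := by
    refine hcard.trans ?_
    calc _ ≤ rexp (6 * S) ^ d := by
          apply pow_le_pow_left₀ (by positivity) (ua_netcard hS)
      _ = _ := by rw [← Real.exp_nat_mul]; ring_nf
  have : IsProbabilityMeasure (iidGaussian d m) := by unfold iidGaussian; infer_instance
  set G : Set (Fin m → EuclideanSpace ℝ (Fin d)) := {a |
            ∀ x : EuclideanSpace ℝ (Fin d), 0 < ‖x‖ → ‖x‖ ≤ S →
              ‖x - xstar‖ / (4 * Real.sqrt π * (1 + 9 * π * ‖xstar‖ ^ 2)) ≤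
                (1 / m) * ∑ i, Real.exp (-⟪a i, x⟫) * |⟪a i, x - xstar⟫| *
                  (if 0 < ⟪a i, x⟫ then (1 : ℝ) else 0) ∧
              ‖x - xstar‖ / (4 * Real.sqrt π * (1 + 9 * π * ‖xstar‖ ^ 2)) ≤
                ⟪subgrad xstar a x, x - xstar⟫} with hG
  let B1 : Set (Fin m → EuclideanSpace ℝ (Fin d)) := ⋃ p ∈ s ×ˢ s,
    {a | ∑ i, uaPsi S ⟪a i, p.1⟫ * |⟪a i, p.2⟫| ≤ m * (0.055 / S ^ 2)}
  let B2 : Set (Fin m → EuclideanSpace ℝ (Fin d)) := ⋃ v ∈ s, {a | m * 4 ≤ ∑ i, ⟪a i, v⟫ ^ 2}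
  have hsub : Set.univ ⊆ G ∪ (B1 ∪ B2) := by
    intro a _
    by_cases hB : a ∈ B1 ∪ B2
    · exact Or.inr hB
    left
    rw [Set.mem_union, not_or] at hB
    obtain ⟨hb1, hb2⟩ := hB
    simp only [B1, B2, Set.mem_iUnion, not_exists, Set.mem_ofPred_eq, not_le, Prod.forall,
      Finset.mem_product, and_imp] at hb1 hb2
    have hun : ∀ u z : EuclideanSpace ℝ (Fin d), ‖u‖ = 1 → ‖z‖ = 1 →
        m * (0.046 / S ^ 2) ≤ ∑ i, uaPsi S ⟪a i, u⟫ * |⟪a i, z⟫| := fun u z hu hz =>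
      ua_unif hS hs1 hs (fun v hv => (hb2 v hv).le)
        (fun u hu z hz => (hb1 u z hu hz).le) hu hz
    intro x hx0 hx
    have h1 := ua_point hm hR hun hx0 hx
    exact ⟨h1, h1.trans (ua_subgrad xstar a x)⟩
  have hmS : 12345 * d * S ^ 4 ≤ m := by
    refine le_trans ?_ hC
    rw [hSdef, mul_pow]
    have : 0 ≤ (d:ℝ) * ‖xstar‖ ^ 4 := by positivity
    nlinarith
  have hB1 : iidGaussian d m B1 ≤ ENNReal.ofReal (rexp (-d)) := by
    calc iidGaussian d m B1 ≤ ∑ p ∈ s ×ˢ s, ENNReal.ofReal (rexp (-(0.0018 / S ^ 3)) ^ m) := by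
          refine (measure_biUnion_finset_le _ _).trans (Finset.sum_le_sum fun p hp => ?_)
          rw [Finset.mem_product] at hp
          exact ua_conc hS (hs1 _ hp.1) (hs1 _ hp.2)
      _ = ENNReal.ofReal ((s.card * s.card) * rexp (-(0.0018 / S ^ 3)) ^ m) := by
          rw [Finset.sum_const, Finset.card_product, nsmul_eq_mul, ENNReal.ofReal_mul (by positivity)]
          congr 1
          rw [← Nat.cast_mul, ENNReal.ofReal_natCast]
      _ ≤ _ := by
          apply ENNReal.ofReal_le_ofReal
          calc _ ≤ (rexp (6 * d * S) * rexp (6 * d * S)) * rexp (-(0.0018 / S ^ 3)) ^ m := by gcongr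
            _ = rexp (12 * d * S - m * (0.0018 / S ^ 3)) := by
                rw [← Real.exp_nat_mul, ← Real.exp_add, ← Real.exp_add]; ring_nf
            _ ≤ _ := by
                rw [Real.exp_le_exp]
                have : (12345 * d * S ^ 4) * (0.0018 / S ^ 3) ≤ m * (0.0018 / S ^ 3) := by gcongr
                have e : (12345 * d * S ^ 4) * (0.0018 / S ^ 3) = 22.221 * (d * S) := by
                  field_simp; norm_num
                have : (d:ℝ) ≤ d * S := by nlinarith
                nlinarith
  have hB2 : iidGaussian d m B2 ≤ ENNReal.ofReal (rexp (-d)) := by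
    calc iidGaussian d m B2 ≤ ∑ v ∈ s, ENNReal.ofReal (rexp (-(1 / 2)) ^ m) := by
          refine (measure_biUnion_finset_le _ _).trans (Finset.sum_le_sum fun v hv => ?_)
          exact ua_opconc (hs1 _ hv)
      _ = ENNReal.ofReal (s.card * rexp (-(1 / 2)) ^ m) := by
          rw [Finset.sum_const, nsmul_eq_mul, ENNReal.ofReal_mul (by positivity)]
          congr 1
          rw [ENNReal.ofReal_natCast]
      _ ≤ _ := by
          apply ENNReal.ofReal_le_ofReal
          calc _ ≤ rexp (6 * d * S) * rexp (-(1 / 2)) ^ m := by gcongr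
            _ = rexp (6 * d * S - m * (1 / 2)) := by
                rw [← Real.exp_nat_mul, ← Real.exp_add]; ring_nf
            _ ≤ _ := by
                rw [Real.exp_le_exp]
                have h1 : S ≤ S ^ 4 := le_self_pow₀ (by linarith) (by norm_num)
                have h2 : (d:ℝ) * S ≤ d * S ^ 4 := by gcongr
                have : (d:ℝ) ≤ d * S := by nlinarith
                nlinarith
  have hfin : 1 ≤ iidGaussian d m G + ENNReal.ofReal (2 * rexp (-d)) := by
    calc 1 = iidGaussian d m Set.univ := measure_univ.symm
      _ ≤ iidGaussian d m (G ∪ (B1 ∪ B2)) := measure_mono hsub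
      _ ≤ iidGaussian d m G + (iidGaussian d m B1 + iidGaussian d m B2) :=
          (measure_union_le _ _).trans (by gcongr; exact measure_union_le _ _)
      _ ≤ iidGaussian d m G + (ENNReal.ofReal (rexp (-d)) + ENNReal.ofReal (rexp (-d))) := by gcongr
      _ = _ := by
          rw [← ENNReal.ofReal_add (by positivity) (by positivity), two_mul]
  rw [ENNReal.ofReal_sub _ (by positivity), ENNReal.ofReal_one]
  exact tsub_le_iff_right.2 hfin
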